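/- For every σ ∈ Z²(G,kˣ) and every 2-coboundary β ∈ B²(G,kˣ), one has σ♯β = σ·β = β♯σ (the pointwise product). Consequently B²(G,kˣ) is a central subgroup of the group (Z²(G,kˣ), ♯), and ♯ induces a group structure on the quotient H²(G,kˣ) = Z²(G,kˣ)/B²(G,kˣ). -/

import Mathlib

variable (k : Type*) [Field k] (G : Type*) [Group G]

/-- A normalized 2-cocycle on `G` with values in `kˣ` (trivial `G`-action):
`σ(g,h)σ(gh,l) = σ(h,l)σ(g,hl)` and `σ(1,g) = σ(g,1) = 1`. -/
def IsCocycle (σ : G → G → kˣ) : Prop :=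
  (∀ g h l : G, σ g h * σ (g * h) l = σ h l * σ g (h * l)) ∧
    (∀ g : G, σ 1 g = 1) ∧ (∀ g : G, σ g 1 = 1)

/-- A 2-coboundary: `∂γ(g,h) = γ(g)γ(h)γ(gh)⁻¹` for some `γ` with `γ(1) = 1`. -/
def IsCoboundary (σ : G → G → kˣ) : Prop :=
  ∃ γ : G → kˣ, γ 1 = 1 ∧ ∀ g h : G, σ g h = γ g * γ h * (γ (g * h))⁻¹

open Classical in
/-- The degree `|g|_σ ∈ {0,1}` determined by `θ(σ)(g) = σ(g,u)σ(u,g)⁻¹ = (-1)^{|g|_σ}`. -/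
noncomputable def deg (u : G) (σ : G → G → kˣ) (g : G) : ℕ :=
  if σ g u = σ u g then 0 else 1

/-- The sharp product `(σ♯ω)(g,h) = σ(g,h)ω(g,h)(-1)^{|g|_σ |h|_ω}`. -/
noncomputable def sharpFun (u : G) (σ ω : G → G → kˣ) : G → G → kˣ :=
  fun g h => σ g h * ω g h * (-1 : kˣ) ^ (deg k G u σ g * deg k G u ω h)

/-- The candidate ♯-inverse `σ'(g,h) = σ(g,h)⁻¹ (-1)^{|g|_σ |h|_σ}`. -/
noncomputable def sharpInvFun (u : G) (σ : G → G → kˣ) : G → G → kˣ :=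
  fun g h => (σ g h)⁻¹ * (-1 : kˣ) ^ (deg k G u σ g * deg k G u σ h)

theorem deg_mul_coboundary (u : G) (hcen : ∀ g : G, u * g = g * u) (σ σ' : G → G → kˣ)
    (h : IsCoboundary k G (σ * σ'⁻¹)) (g : G) : deg k G u σ g = deg k G u σ' g := by
  obtain ⟨γ, -, h⟩ := h
  have h1 := h g u
  have h2 := h u g
  rw [hcen g, mul_comm (γ u)] at h2
  have h3 : σ g u * (σ' g u)⁻¹ = σ u g * (σ' u g)⁻¹ := h1.trans h2.symm
  unfold deg
  have : σ g u = σ u g ↔ σ' g u = σ' u g := by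
    constructor
    · intro e
      rw [e] at h3
      exact inv_injective (mul_left_cancel h3)
    · intro e
      rw [e] at h3
      exact mul_right_cancel h3
  by_cases e : σ g u = σ u g
  · rw [if_pos e, if_pos (this.1 e)]
  · rw [if_neg e, if_neg (fun e2 => e (this.2 e2))]

theorem deg_coboundary (u : G) (hcen : ∀ g : G, u * g = g * u) (β : G → G → kˣ)
    (h : IsCoboundary k G β) (g : G) : deg k G u β g = 0 := by
  obtain ⟨γ, -, h⟩ := h
  unfold deg
  rw [if_pos]
  rw [h, h, hcen g, mul_comm (γ u)]

/-- For `σ ∈ Z²(G,kˣ)` and a 2-coboundary `β`, `σ♯β = σ·β = β♯σ`; consequently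
`B²(G,kˣ)` is central in `(Z²(G,kˣ),♯)` and `♯` descends to the quotient
`H²(G,kˣ) = Z²/B²` (well-definedness of the induced product). -/
theorem statement3 [Finite G] (u : G) (hcen : ∀ g : G, u * g = g * u) (hu : u ^ 2 = 1) :
    (∀ σ β : G → G → kˣ, IsCocycle k G σ → IsCoboundary k G β →
        sharpFun k G u σ β = σ * β ∧ sharpFun k G u β σ = σ * β) ∧
    (∀ σ σ' ω ω' : G → G → kˣ, IsCocycle k G σ → IsCocycle k G σ' →
        IsCocycle k G ω → IsCocycle k G ω' →
        IsCoboundary k G (σ * σ'⁻¹) → IsCoboundary k G (ω * ω'⁻¹) →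
        IsCoboundary k G (sharpFun k G u σ ω * (sharpFun k G u σ' ω')⁻¹)) := by
  refine ⟨fun σ β _ hβ => ⟨?_, ?_⟩, ?_⟩
  · funext g h
    simp [sharpFun, deg_coboundary k G u hcen β hβ]
  · funext g h
    simp [sharpFun, deg_coboundary k G u hcen β hβ, mul_comm]
  · intro σ σ' ω ω' _ _ _ _ h1 h2
    have d1 := deg_mul_coboundary k G u hcen σ σ' h1
    have d2 := deg_mul_coboundary k G u hcen ω ω' h2
    obtain ⟨γ, hγ, h1⟩ := h1
    obtain ⟨δ, hδ, h2⟩ := h2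
    refine ⟨γ * δ, by simp [hγ, hδ], fun g h => ?_⟩
    have e1 : σ g h * (σ' g h)⁻¹ = _ := h1 g h
    have e2 : ω g h * (ω' g h)⁻¹ = _ := h2 g h
    have e : (sharpFun k G u σ ω * (sharpFun k G u σ' ω')⁻¹) g h
        = (σ g h * (σ' g h)⁻¹) * (ω g h * (ω' g h)⁻¹) := by
      simp only [sharpFun, Pi.mul_apply, Pi.inv_apply, d1, d2, mul_inv]
      generalize (-1 : kˣ) ^ (deg k G u σ' g * deg k G u ω' h) = z
      rw [show σ g h * ω g h * z * ((σ' g h)⁻¹ * (ω' g h)⁻¹ * z⁻¹)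
        = σ g h * ω g h * ((σ' g h)⁻¹ * (ω' g h)⁻¹) * (z * z⁻¹) by ac_rfl, mul_inv_cancel, mul_one]
      ac_rfl
    rw [e, e1, e2]
    simp only [Pi.mul_apply, mul_inv]
    ac_rfl
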